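/- Let n, k, p be positive integers with n ≥ p, let i = (i_1,…,i_p), i' = (i'_1,…,i'_p), j = (j_1,…,j_p), j' = (j'_1,…,j'_p) be p-tuples of integers from [n] = {1,…,n}, and let l = (l_1,…,l_p), l' = (l'_1,…,l'_p) be p-tuples of integers from [k]. If U^{(1)},…,U^{(k)} are independent Haar-distributed random unitary matrices in U(n), then E[ U^{(l_1)}_{i_1 j_1} ⋯ U^{(l_p)}_{i_p j_p} · conj(U^{(l'_1)}_{i'_1 j'_1}) ⋯ conj(U^{(l'_p)}_{i'_p j'_p}) ] = Σ_{α,β ∈ S_p^{l→l'}} δ_{i_1 i'_{α(1)}} ⋯ δ_{i_p i'_{α(p)}} · δ_{j_1 j'_{β(1)}} ⋯ δ_{j_p j'_{β(p)}} · ∏_{s=1}^k Wg(n, α_s^{-1} β_s), where α = α_1 × ⋯ × α_k and β = β_1 × ⋯ × β_k are the decompositions of α and β along the level sets of l and l'. Moreover, if the numbers of U factors and conjugate-U factors differ, the expectation is 0. -/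

import Mathlib

open MeasureTheory Matrix Filter
open scoped BigOperators ComplexConjugate

noncomputable instance matMS (m n : Type*) : MeasurableSpace (Matrix m n ℂ) := by unfold Matrix; infer_instance

noncomputable instance ugMS (n : ℕ) : MeasurableSpace (Matrix.unitaryGroup (Fin n) ℂ) := borel _
instance ugBS (n : ℕ) : BorelSpace (Matrix.unitaryGroup (Fin n) ℂ) := ⟨rfl⟩

/-- number of cycles (including fixed points) of a permutation -/
def numCycles {α : Type*} [Fintype α] [DecidableEq α] (σ : Equiv.Perm α) : ℕ :=
  σ.cycleType.card + (Fintype.card α - σ.cycleType.sum)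

/-- The unitary Weingarten function `Wg(n, σ)`: the coefficient at `σ` of the inverse, under
convolution in the group algebra of the symmetric group, of the function `σ ↦ n ^ #σ`. -/
noncomputable def Wg (n : ℕ) {α : Type*} [Fintype α] [DecidableEq α] (σ : Equiv.Perm α) : ℝ :=
  (Ring.inverse (∑ τ : Equiv.Perm α, ((n : ℝ) ^ numCycles τ) • MonoidAlgebra.single τ (1 : ℝ) :
    MonoidAlgebra ℝ (Equiv.Perm α))).coeff σ

/-- a product of two permutations mapping level sets of `l` to level sets of `l'`
preserves each level set of `l` -/
theorem levelPreserving {p k : ℕ} (l l' : Fin p → Fin k) (α β : Equiv.Perm (Fin p))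
    (hα : ∀ t, l' (α t) = l t) (hβ : ∀ t, l' (β t) = l t) :
    ∀ t, l ((α⁻¹ * β) t) = l t := fun t => by
  have h1 : l' (α (α⁻¹ (β t))) = l (α⁻¹ (β t)) := hα _
  rw [show α (α⁻¹ (β t)) = β t from Equiv.apply_symm_apply α (β t)] at h1
  simpa [Equiv.Perm.mul_apply, h1] using (hβ t).symm ▸ h1.symm

/-- the restriction `σ_s` of a level-set-preserving permutation `σ` to the level set
`l⁻¹(s)` -/
def restrictPerm {p k : ℕ} (l : Fin p → Fin k) (σ : Equiv.Perm (Fin p))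
    (h : ∀ t, l (σ t) = l t) (s : Fin k) : Equiv.Perm {t : Fin p // l t = s} :=
  σ.subtypePerm (fun t => by rw [h t])


theorem card_comp_perm_eq_self {α : Type*} [Fintype α] [DecidableEq α] (n : ℕ)
    (σ : Equiv.Perm α) :
    (Finset.univ.filter fun f : α → Fin n => f ∘ σ = f).card = n ^ numCycles σ := by
  let S := ↥σ.cycleFactorsFinset ⊕ {x // σ x = x}
  let g : α → S := fun x =>
    if h : σ x = x then Sum.inr ⟨x, h⟩
    else Sum.inl ⟨σ.cycleOf x, by
      rwa [Equiv.Perm.cycleOf_mem_cycleFactorsFinset_iff, Equiv.Perm.mem_support]⟩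
  have hgs : ∀ x, g (σ x) = g x := by
    intro x
    by_cases h : σ x = x
    · rw [h]
    · have h' : σ (σ x) ≠ σ x := fun e => h (σ.injective e)
      simp only [g, h, h', dite_false]
      congr 2
      exact Equiv.Perm.cycleOf_self_apply σ x
  have hgk : ∀ x y, g x = g y → σ.SameCycle x y := by
    intro x y hxy
    by_cases h : σ x = x <;> by_cases h' : σ y = y <;>
      simp only [g, h, h', dite_true, dite_false, reduceCtorEq] at hxy
    · rw [Subtype.mk.inj (Sum.inr.inj hxy)]
    · exact (Equiv.Perm.sameCycle_iff_cycleOf_eq_of_mem_support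
        (Equiv.Perm.mem_support.2 h) (Equiv.Perm.mem_support.2 h')).2 (Subtype.mk.inj (Sum.inl.inj hxy))
  have hgsurj : Function.Surjective g := by
    rintro (⟨c, hc⟩ | ⟨x, hx⟩)
    · obtain ⟨x, hx⟩ := (Equiv.Perm.mem_cycleFactorsFinset_iff.1 hc).1.nonempty_support
      have e := Equiv.Perm.cycle_is_cycleOf hx hc
      have hx' : σ x ≠ x :=
        Equiv.Perm.mem_support.1 (Equiv.Perm.mem_cycleFactorsFinset_support_le hc hx)
      exact ⟨x, by simp [g, hx', e]⟩
    · exact ⟨x, by simp [g, hx]⟩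
  have hcard : Fintype.card S = numCycles σ := by
    have h1 : Fintype.card {x // σ x = x} = Fintype.card α - σ.support.card := by
      rw [Fintype.card_subtype, ← Finset.card_compl]
      congr 1
      ext x
      simp
    rw [numCycles, Equiv.Perm.sum_cycleType, Equiv.Perm.cycleType_def]
    simp [S, h1]
  have hcard' : Fintype.card (S → Fin n) = n ^ Fintype.card S := by simp
  rw [← hcard, ← hcard', ← Finset.card_univ]
  symm
  refine Finset.card_bij (fun h _ => h ∘ g) ?_ ?_ ?_
  · intro h _
    simp only [Finset.mem_filter, Finset.mem_univ, true_and]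
    funext x
    simp [hgs]
  · intro h _ h' _ e
    exact hgsurj.injective_comp_right e
  · intro f hf
    simp only [Finset.mem_filter, Finset.mem_univ, true_and] at hf
    have hz : ∀ x y, σ.SameCycle x y → f x = f y := by
      intro x y hxy
      obtain ⟨m, _, rfl⟩ := hxy.exists_pow_eq'
      clear hxy
      induction m with
      | zero => rfl
      | succ m ih =>
        have := congrFun hf ((σ ^ m) x)
        simp only [Function.comp_apply] at this
        rw [pow_succ', Equiv.Perm.mul_apply, this]
        exact ih (by omega)
    refine ⟨f ∘ Function.surjInv hgsurj, Finset.mem_univ _, ?_⟩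
    funext x
    exact hz _ _ (hgk _ _ (Function.surjInv_eq hgsurj (g x)))

theorem exists_equiv_comp_eq {P P' S : Type*} [Fintype P] [Fintype P'] [DecidableEq S]
    (l : P → S) (l' : P' → S)
    (h : ∀ s, Fintype.card {t // l t = s} = Fintype.card {t // l' t = s}) :
    ∃ σ : P ≃ P', ∀ t, l' (σ t) = l t := by
  let e : ∀ s, {t // l t = s} ≃ {t // l' t = s} := fun s => Fintype.equivOfCardEq (h s)
  refine ⟨(Equiv.sigmaFiberEquiv l).symm.trans
    ((Equiv.sigmaCongrRight e).trans (Equiv.sigmaFiberEquiv l')), fun t => ?_⟩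
  exact (e (l t) ⟨t, rfl⟩).2

/-- The element `σ ↦ n ^ #σ` of the group algebra. -/
noncomputable def cycleElement (n : ℕ) (P : Type*) [Fintype P] [DecidableEq P] :
    MonoidAlgebra ℝ (Equiv.Perm P) :=
  ∑ τ : Equiv.Perm P, ((n : ℝ) ^ numCycles τ) • MonoidAlgebra.single τ (1 : ℝ)

section GroupAlgebra

variable {P : Type*} [Fintype P] [DecidableEq P]

theorem coeff_cycleElement (n : ℕ) (σ : Equiv.Perm P) :
    (cycleElement n P).coeff σ = (n : ℝ) ^ numCycles σ := by
  simp [cycleElement, MonoidAlgebra.coeff_sum, Finsupp.finsetSum_apply, Finsupp.single_apply]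

theorem coeff_mul_eq_sum (x y : MonoidAlgebra ℝ (Equiv.Perm P)) (σ : Equiv.Perm P) :
    (x * y).coeff σ = ∑ τ, x.coeff τ * y.coeff (τ⁻¹ * σ) := by
  rw [MonoidAlgebra.coeff_mul, Finsupp.sum_fintype _ _ (by simp)]
  refine Finset.sum_congr rfl fun τ _ => ?_
  rw [Finsupp.sum_fintype _ _ (by simp)]
  rw [Finset.sum_eq_single (τ⁻¹ * σ)]
  · simp
  · intro b _ hb
    rw [if_neg]
    rintro rfl
    exact hb (by simp)
  · simp

/-- The trace of `P_τ⁻¹ P_α` on the `P`-fold tensor power of an `n`-dimensional space. -/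
theorem sum_indicator_comp (R : Type*) [CommSemiring R] (n : ℕ) (τ α : Equiv.Perm P) :
    ∑ f : P → Fin n, (if f ∘ τ = f ∘ α then (1 : R) else 0) =
      (n : R) ^ numCycles (τ⁻¹ * α) := by
  rw [Finset.sum_boole, ← Nat.cast_pow, ← card_comp_perm_eq_self n (τ⁻¹ * α)]
  congr 1
  refine Finset.card_bij (fun f _ => f ∘ τ) ?_ ?_ ?_
  · intro f hf
    simp only [Finset.mem_filter, Finset.mem_univ, true_and] at hf ⊢
    funext x
    simpa using (congrFun hf x).symm
  · intro f _ g _ e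
    exact τ.surjective.injective_comp_right e
  · intro f hf
    simp only [Finset.mem_filter, Finset.mem_univ, true_and] at hf
    refine ⟨f ∘ τ.symm, ?_, ?_⟩
    · simp only [Finset.mem_filter, Finset.mem_univ, true_and]
      funext x
      have := congrFun hf x
      simpa using this.symm
    · funext x
      simp

theorem isUnit_cycleElement {n : ℕ} (hn : Fintype.card P ≤ n) : IsUnit (cycleElement n P) := by
  have hinj : ∀ x : MonoidAlgebra ℝ (Equiv.Perm P), x * cycleElement n P = 0 → x = 0 := by
    intro x hx
    obtain ⟨e⟩ : Nonempty (P ↪ Fin n) :=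
      Function.Embedding.nonempty_of_card_le (by simpa using hn)
    have key : ∑ f : P → Fin n, ∑ g : P → Fin n,
        (∑ σ : Equiv.Perm P, if f = g ∘ σ then x.coeff σ else 0) ^ 2 = 0 := by
      calc _ = ∑ σ : Equiv.Perm P, ∑ τ : Equiv.Perm P, ∑ g : P → Fin n,
            x.coeff σ * x.coeff τ * (if g ∘ τ = g ∘ σ then 1 else 0) := by
            rw [Finset.sum_comm]
            simp_rw [pow_two, Finset.sum_mul_sum]
            simp_rw [Finset.sum_comm (s := (Finset.univ : Finset (P → Fin n)))
              (t := (Finset.univ : Finset (Equiv.Perm P)))]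
            refine Finset.sum_congr rfl fun σ _ => Finset.sum_congr rfl fun τ _ =>
              Finset.sum_congr rfl fun g _ => ?_
            rw [Finset.sum_eq_single (g ∘ σ)]
            · by_cases h : g ∘ τ = g ∘ σ
              · simp [h]
              · simp [h, Ne.symm h]
            · intro f _ hf
              simp [hf]
            · simp
        _ = ∑ σ : Equiv.Perm P, x.coeff σ * (x * cycleElement n P).coeff σ := by
            refine Finset.sum_congr rfl fun σ _ => ?_
            rw [coeff_mul_eq_sum, Finset.mul_sum]
            refine Finset.sum_congr rfl fun τ _ => ?_
            rw [← Finset.mul_sum, sum_indicator_comp, coeff_cycleElement, mul_assoc]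
        _ = 0 := by simp [hx]
    have hzero : ∀ f g : P → Fin n,
        (∑ σ : Equiv.Perm P, if f = g ∘ σ then x.coeff σ else 0) = 0 := by
      intro f g
      have h1 := (Finset.sum_eq_zero_iff_of_nonneg
        (fun f _ => Finset.sum_nonneg fun g _ => sq_nonneg _)).1 key f (Finset.mem_univ _)
      have h2 := (Finset.sum_eq_zero_iff_of_nonneg
        (fun g _ => sq_nonneg _)).1 h1 g (Finset.mem_univ _)
      exact pow_eq_zero_iff two_ne_zero |>.1 h2
    ext σ
    have h := hzero (e ∘ σ) e
    rw [Finset.sum_eq_single σ] at h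
    · simpa using h
    · intro τ _ hτ
      rw [if_neg]
      intro he
      exact hτ (Equiv.ext fun t => (e.injective (congrFun he t)).symm)
    · simp
  have hsurj : Function.Surjective (LinearMap.mulRight ℝ (cycleElement n P)) := by
    rw [← LinearMap.injective_iff_surjective, injective_iff_map_eq_zero]
    simpa using hinj
  obtain ⟨y, hy⟩ := hsurj 1
  rw [LinearMap.mulRight_apply] at hy
  refine ⟨⟨cycleElement n P, y, ?_, hy⟩, rfl⟩
  refine sub_eq_zero.1 (hinj _ ?_)
  rw [sub_mul, mul_assoc, hy, mul_one, one_mul, sub_self]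

/-- Inversion of the Gram system by the Weingarten function. -/
theorem eq_sum_Wg_of_gram {n : ℕ} (hn : Fintype.card P ≤ n) (c d : Equiv.Perm P → ℂ)
    (h : ∀ τ, ∑ α, c α * (n : ℂ) ^ numCycles (τ⁻¹ * α) = d τ) (α : Equiv.Perm P) :
    c α = ∑ β, (Wg n (α⁻¹ * β) : ℂ) * d β := by
  have hinv : Ring.inverse (cycleElement n P) * cycleElement n P = 1 :=
    Ring.inverse_mul_cancel _ (isUnit_cycleElement hn)
  have hW : ∀ σ : Equiv.Perm P, ∑ τ : Equiv.Perm P,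
      (Wg n τ : ℂ) * (n : ℂ) ^ numCycles (τ⁻¹ * σ) = if σ = 1 then 1 else 0 := by
    intro σ
    have h1 := congrArg (fun x => x.coeff σ) hinv
    simp only [coeff_mul_eq_sum, coeff_cycleElement] at h1
    rw [MonoidAlgebra.one_def, MonoidAlgebra.coeff_single, Finsupp.single_apply] at h1
    have h2 := congrArg (fun r : ℝ => (r : ℂ)) h1
    simpa [Wg, cycleElement, eq_comm, apply_ite Complex.ofReal] using h2
  simp_rw [← h, Finset.mul_sum]
  rw [Finset.sum_comm]
  have : ∀ γ : Equiv.Perm P, ∑ β : Equiv.Perm P, (Wg n (α⁻¹ * β) : ℂ) *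
      (c γ * (n : ℂ) ^ numCycles (β⁻¹ * γ)) = c γ * if α⁻¹ * γ = 1 then 1 else 0 := by
    intro γ
    rw [← hW, Finset.mul_sum]
    refine Fintype.sum_equiv (Equiv.mulLeft α⁻¹) _ _ fun β => ?_
    simp [mul_assoc]
    ring
  simp_rw [this, inv_mul_eq_one]
  simp

end GroupAlgebra

section TensorPower

variable {P : Type*} [Fintype P] {n : ℕ}

/-- The matrix of the tensor power of `A` indexed by `P`. -/
def tensorPow {R ι : Type*} [CommSemiring R] (P : Type*) [Fintype P] (A : Matrix ι ι R) :
    Matrix (P → ι) (P → ι) R :=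
  Matrix.of fun f g => ∏ t, A (f t) (g t)

theorem tensorPow_apply {R ι : Type*} [CommSemiring R] (A : Matrix ι ι R) (f g : P → ι) :
    tensorPow P A f g = ∏ t, A (f t) (g t) := rfl

theorem tensorPow_mul [DecidableEq P] (A B : Matrix (Fin n) (Fin n) ℂ) :
    tensorPow P (A * B) = tensorPow P A * tensorPow P B := by
  ext f g
  simp only [tensorPow_apply, Matrix.mul_apply, ← Finset.prod_mul_distrib]
  exact Fintype.prod_sum _

theorem tensorPow_one : tensorPow P (1 : Matrix (Fin n) (Fin n) ℂ) = 1 := by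
  ext f g
  simp only [tensorPow_apply, Matrix.one_apply, Finset.prod_ite_zero, Finset.prod_const_one,
    funext_iff, Finset.mem_univ, true_imp_iff]

theorem tensorPow_conjTranspose (A : Matrix (Fin n) (Fin n) ℂ) :
    tensorPow P Aᴴ = (tensorPow P A)ᴴ := by
  ext f g
  simp [tensorPow_apply, Matrix.conjTranspose_apply]

/-- `exp I` is a point of the unit circle with pairwise distinct powers. -/
theorem exp_I_pow_injective : Function.Injective fun m : ℕ => Complex.exp Complex.I ^ m := by
  intro a b h
  simp only [← Complex.exp_nat_mul] at h
  obtain ⟨m, hm⟩ := Complex.exp_eq_exp_iff_exists_int.1 h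
  have h2 : (a : ℝ) = b + m * (2 * Real.pi) := by
    have := congrArg Complex.im hm
    simpa using this
  by_cases hm0 : m = 0
  · subst hm0
    simpa using h2
  · exfalso
    refine irrational_pi ⟨((a : ℚ) - b) / (2 * m), ?_⟩
    have : (m : ℝ) ≠ 0 := by exact_mod_cast hm0
    push_cast
    field_simp
    linarith

theorem star_exp_I_mul : star (Complex.exp Complex.I) * Complex.exp Complex.I = 1 := by
  rw [Complex.star_def, ← Complex.exp_conj, ← Complex.exp_add]
  simp

theorem prod_ite_eq_pow_card {S : Type*} [DecidableEq S] (f : P → S) (a : S) (z : ℂ) :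
    ∏ t, (if f t = a then z else 1) = z ^ Fintype.card {t // f t = a} := by
  rw [Fintype.card_subtype, Finset.prod_ite]
  simp

/-- The diagonal matrix with entry `exp I` at `a` and `1` elsewhere. -/
noncomputable def phaseAt (a : Fin n) : Matrix.unitaryGroup (Fin n) ℂ :=
  ⟨Matrix.diagonal fun b => if b = a then Complex.exp Complex.I else 1, by
    rw [Matrix.mem_unitaryGroup_iff', Matrix.star_eq_conjTranspose, Matrix.diagonal_conjTranspose,
      Matrix.diagonal_mul_diagonal, ← Matrix.diagonal_one]
    congr 1
    funext b
    by_cases h : b = a <;> simp [h, -RCLike.star_def, -Complex.star_def, star_exp_I_mul]⟩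

theorem tensorPow_diagonal [DecidableEq P] (d : Fin n → ℂ) :
    tensorPow P (Matrix.diagonal d) = Matrix.diagonal fun f : P → Fin n => ∏ t, d (f t) := by
  ext f g
  simp only [tensorPow_apply, Matrix.diagonal_apply, Finset.prod_ite_zero, Finset.mem_univ,
    true_imp_iff, funext_iff]

variable [DecidableEq P] {T : Matrix (P → Fin n) (P → Fin n) ℂ}

theorem exists_perm_of_commute_unitary
    (hT : ∀ U : Matrix.unitaryGroup (Fin n) ℂ,
      Commute T (tensorPow P (U : Matrix (Fin n) (Fin n) ℂ)))
    {f g : P → Fin n} (hfg : T f g ≠ 0) : ∃ σ : Equiv.Perm P, f = g ∘ σ := by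
  obtain ⟨σ, hσ⟩ := exists_equiv_comp_eq f g fun a => by
    apply exp_I_pow_injective
    have h := congrFun (congrFun (hT (phaseAt a)) f) g
    simp only [phaseAt, tensorPow_diagonal, Matrix.mul_diagonal, Matrix.diagonal_mul] at h
    rw [mul_comm] at h
    have h := mul_right_cancel₀ hfg h
    simpa only [prod_ite_eq_pow_card] using h.symm
  exact ⟨σ, funext fun t => (hσ t).symm⟩

theorem commute_tensorPow_diagonal
    (hT : ∀ U : Matrix.unitaryGroup (Fin n) ℂ,
      Commute T (tensorPow P (U : Matrix (Fin n) (Fin n) ℂ))) (d : Fin n → ℂ) :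
    Commute T (tensorPow P (Matrix.diagonal d)) := by
  rw [tensorPow_diagonal]
  ext f g
  rw [Matrix.mul_diagonal, Matrix.diagonal_mul]
  by_cases h : T f g = 0
  · simp [h]
  · obtain ⟨σ, rfl⟩ := exists_perm_of_commute_unitary hT h
    rw [mul_comm]
    congr 1
    exact (Equiv.prod_comp σ fun t => d (g t)).symm

theorem commute_tensorPow_of_isHermitian
    (hT : ∀ U : Matrix.unitaryGroup (Fin n) ℂ,
      Commute T (tensorPow P (U : Matrix (Fin n) (Fin n) ℂ)))
    {H : Matrix (Fin n) (Fin n) ℂ} (hH : H.IsHermitian) : Commute T (tensorPow P H) := by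
  obtain ⟨U, d, h⟩ : ∃ (U : Matrix.unitaryGroup (Fin n) ℂ) (d : Fin n → ℂ),
      H = (U : Matrix (Fin n) (Fin n) ℂ) * Matrix.diagonal d *
        ((star U : Matrix.unitaryGroup (Fin n) ℂ) : Matrix (Fin n) (Fin n) ℂ) :=
    ⟨_, _, hH.spectral_theorem.trans (Unitary.conjStarAlgAut_apply _ _)⟩
  rw [h, tensorPow_mul, tensorPow_mul]
  exact ((hT U).mul_right (commute_tensorPow_diagonal hT d)).mul_right (hT (star U))

theorem commute_tensorPow
    (hT : ∀ U : Matrix.unitaryGroup (Fin n) ℂ,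
      Commute T (tensorPow P (U : Matrix (Fin n) (Fin n) ℂ)))
    (A : Matrix (Fin n) (Fin n) ℂ) : Commute T (tensorPow P A) := by
  obtain ⟨H, K, hH, hK, rfl⟩ : ∃ H K : Matrix (Fin n) (Fin n) ℂ,
      H.IsHermitian ∧ K.IsHermitian ∧ A = H + Complex.I • K := by
    have := realPart_add_I_smul_imaginaryPart A
    exact ⟨realPart A, imaginaryPart A, (realPart A).2, (imaginaryPart A).2, this.symm⟩
  ext f g
  let B : Matrix (Fin n) (Fin n) (Polynomial ℂ) :=
    Matrix.of fun a b => Polynomial.C (H a b) + Polynomial.X * Polynomial.C (K a b)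
  let q : Polynomial ℂ := ∑ m, Polynomial.C (T f m) * tensorPow P B m g -
    ∑ m, tensorPow P B f m * Polynomial.C (T m g)
  have hq : ∀ z : ℂ, q.eval z = (T * tensorPow P (H + z • K)) f g -
      (tensorPow P (H + z • K) * T) f g := by
    intro z
    simp [q, B, tensorPow_apply, Matrix.mul_apply, Polynomial.eval_finsetSum,
      Polynomial.eval_prod, mul_comm z]
  have hq0 : q = 0 := by
    refine Polynomial.eq_zero_of_infinite_isRoot q
      (Set.Infinite.mono ?_ (Set.infinite_range_of_injective Complex.ofReal_injective))
    rintro _ ⟨x, rfl⟩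
    have hx : (H + (x : ℂ) • K).IsHermitian := by
      refine hH.add ?_
      rw [Matrix.IsHermitian, Matrix.conjTranspose_smul, hK.eq]
      simp
    rw [Set.mem_ofPred_eq, Polynomial.IsRoot, hq, (commute_tensorPow_of_isHermitian hT hx).eq, sub_self]
  have := hq Complex.I
  rw [hq0, Polynomial.eval_zero] at this
  exact (sub_eq_zero.1 this.symm)

/-- A matrix commuting with all tensor powers of unitaries is a combination of the permutation
operators, when the dimension is at least the number of tensor factors. -/
theorem exists_coeff_of_commute (hn : Fintype.card P ≤ n)
    (hT : ∀ U : Matrix.unitaryGroup (Fin n) ℂ,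
      Commute T (tensorPow P (U : Matrix (Fin n) (Fin n) ℂ))) :
    ∃ c : Equiv.Perm P → ℂ, ∀ f g, T f g = ∑ σ, c σ * if f = g ∘ σ then 1 else 0 := by
  obtain ⟨e⟩ : Nonempty (P ↪ Fin n) :=
    Function.Embedding.nonempty_of_card_le (by simpa using hn)
  refine ⟨fun σ => T (e ∘ σ) e, fun f g => ?_⟩
  let A : Matrix (Fin n) (Fin n) ℂ :=
    Matrix.of fun a b => if ∃ t, b = e t ∧ a = g t then 1 else 0
  have hA : ∀ (h : P → Fin n) (σ : Equiv.Perm P),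
      tensorPow P A h (e ∘ σ) = if h = g ∘ σ then 1 else 0 := by
    intro h σ
    have h1 : ∀ t, A (h t) ((e ∘ σ) t) = if h t = (g ∘ σ) t then 1 else 0 := by
      intro t
      simp [A, e.injective.eq_iff]
    simp only [tensorPow_apply, h1, Finset.prod_ite_zero, Finset.prod_const_one,
      funext_iff, Finset.mem_univ, true_imp_iff]
  have hc := congrFun (congrFun (commute_tensorPow hT A).eq f) e
  have hl : (T * tensorPow P A) f e = T f g := by
    rw [Matrix.mul_apply, Finset.sum_eq_single g]
    · have := hA g 1
      simp at this
      rw [this, mul_one]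
    · intro m _ hm
      have := hA m 1
      simp [hm] at this
      rw [this, mul_zero]
    · simp
  rw [← hl, hc, Matrix.mul_apply]
  symm
  refine Finset.sum_of_injOn (fun σ : Equiv.Perm P => e ∘ σ) ?_ ?_ ?_ ?_
  · intro σ _ τ _ h
    exact Equiv.ext fun t => e.injective (congrFun h t)
  · simp
  · intro m _ hm
    by_cases h0 : T m e = 0
    · rw [h0, mul_zero]
    · obtain ⟨σ, rfl⟩ := exists_perm_of_commute_unitary hT h0
      exact absurd ⟨σ, by simp⟩ hm
  · intro σ _
    rw [hA, mul_comm]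

end TensorPower

section Haar

variable {P : Type*} [Fintype P] {n : ℕ}

theorem continuous_entry (a b : Fin n) :
    Continuous fun U : Matrix.unitaryGroup (Fin n) ℂ => (U : Matrix (Fin n) (Fin n) ℂ) a b :=
  continuous_subtype_val.matrix_elem a b

theorem integrable_moment (μ : Measure (Matrix.unitaryGroup (Fin n) ℂ)) [IsFiniteMeasure μ]
    (i j i' j' : P → Fin n) :
    Integrable (fun U : Matrix.unitaryGroup (Fin n) ℂ =>
      (∏ t, (U : Matrix (Fin n) (Fin n) ℂ) (i t) (j t)) *
        ∏ t, star ((U : Matrix (Fin n) (Fin n) ℂ) (i' t) (j' t))) μ := by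
  refine Integrable.of_bound (C := 1) (Continuous.aestronglyMeasurable ?_)
    (Filter.Eventually.of_forall fun U => ?_)
  · exact (continuous_finsetProd _ fun t _ => continuous_entry _ _).mul
      (continuous_finsetProd _ fun t _ => (continuous_entry _ _).star)
  · have h : ∀ i j : P → Fin n, ‖∏ t, (U : Matrix (Fin n) (Fin n) ℂ) (i t) (j t)‖ ≤ 1 := by
      intro i j
      rw [norm_prod]
      exact Finset.prod_le_one (fun _ _ => norm_nonneg _)
        fun t _ => entry_norm_bound_of_unitary U.2 _ _
    rw [← star_prod, norm_mul, norm_star]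
    exact mul_le_one₀ (h _ _) (norm_nonneg _) (h _ _)

variable (μ : Measure (Matrix.unitaryGroup (Fin n) ℂ))

/-- The moment `E[∏ U_{f t, j t} ∏ conj U_{g t, j' t}]` as a matrix in `f` and `g`. -/
noncomputable def momentMatrix (j j' : P → Fin n) : Matrix (P → Fin n) (P → Fin n) ℂ :=
  Matrix.of fun f g => ∫ U : Matrix.unitaryGroup (Fin n) ℂ,
    (∏ t, (U : Matrix (Fin n) (Fin n) ℂ) (f t) (j t)) *
      ∏ t, star ((U : Matrix (Fin n) (Fin n) ℂ) (g t) (j' t)) ∂μ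

variable [DecidableEq P] [IsProbabilityMeasure μ]

theorem tensorPow_mul_momentMatrix_mul [μ.IsHaarMeasure] (j j' : P → Fin n)
    (W : Matrix.unitaryGroup (Fin n) ℂ) :
    tensorPow P (W : Matrix (Fin n) (Fin n) ℂ) * momentMatrix μ j j' *
      tensorPow P (W : Matrix (Fin n) (Fin n) ℂ)ᴴ = momentMatrix μ j j' := by
  ext f g
  symm
  calc momentMatrix μ j j' f g = ∫ U : Matrix.unitaryGroup (Fin n) ℂ,
        (∏ t, ((W * U : Matrix.unitaryGroup (Fin n) ℂ) : Matrix (Fin n) (Fin n) ℂ) (f t) (j t)) *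
          ∏ t, star (((W * U : Matrix.unitaryGroup (Fin n) ℂ) : Matrix (Fin n) (Fin n) ℂ)
            (g t) (j' t)) ∂μ :=
        (integral_mul_left_eq_self (μ := μ) (fun U : Matrix.unitaryGroup (Fin n) ℂ =>
          (∏ t, (U : Matrix (Fin n) (Fin n) ℂ) (f t) (j t)) *
            ∏ t, star ((U : Matrix (Fin n) (Fin n) ℂ) (g t) (j' t))) W).symm
    _ = ∫ U : Matrix.unitaryGroup (Fin n) ℂ, ∑ b : P → Fin n, ∑ a : P → Fin n,
          (tensorPow P (W : Matrix (Fin n) (Fin n) ℂ) f a *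
            star (tensorPow P (W : Matrix (Fin n) (Fin n) ℂ) g b)) *
          ((∏ t, (U : Matrix (Fin n) (Fin n) ℂ) (a t) (j t)) *
            ∏ t, star ((U : Matrix (Fin n) (Fin n) ℂ) (b t) (j' t))) ∂μ := by
        refine integral_congr_ae (Filter.Eventually.of_forall fun U => ?_)
        have h : ∀ f j : P → Fin n, ∏ t, ((W * U : Matrix.unitaryGroup (Fin n) ℂ) :
            Matrix (Fin n) (Fin n) ℂ) (f t) (j t) =
            ∑ a, tensorPow P (W : Matrix (Fin n) (Fin n) ℂ) f a *
              ∏ t, (U : Matrix (Fin n) (Fin n) ℂ) (a t) (j t) := by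
          intro f j
          rw [← tensorPow_apply, Matrix.UnitaryGroup.mul_val, tensorPow_mul, Matrix.mul_apply]
          rfl
        simp only [← star_prod]
        rw [h, h, star_sum, Finset.sum_mul_sum, Finset.sum_comm]
        refine Finset.sum_congr rfl fun b _ => Finset.sum_congr rfl fun a _ => ?_
        rw [star_mul']
        ring
    _ = _ := by
        rw [integral_finsetSum _ fun b _ => integrable_finsetSum _ fun a _ =>
          (integrable_moment μ _ _ _ _).const_mul _]
        rw [tensorPow_conjTranspose]
        simp only [Matrix.mul_apply, Finset.sum_mul]
        refine Finset.sum_congr rfl fun b _ => ?_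
        rw [integral_finsetSum _ fun a _ => (integrable_moment μ _ _ _ _).const_mul _]
        refine Finset.sum_congr rfl fun a _ => ?_
        rw [integral_const_mul, Matrix.conjTranspose_apply]
        simp only [momentMatrix, Matrix.of_apply]
        ring

theorem commute_momentMatrix [μ.IsHaarMeasure] (j j' : P → Fin n)
    (W : Matrix.unitaryGroup (Fin n) ℂ) :
    Commute (momentMatrix μ j j') (tensorPow P (W : Matrix (Fin n) (Fin n) ℂ)) := by
  have h := tensorPow_mul_momentMatrix_mul μ j j' W
  have hW : tensorPow P (W : Matrix (Fin n) (Fin n) ℂ)ᴴ *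
      tensorPow P (W : Matrix (Fin n) (Fin n) ℂ) = 1 := by
    rw [← tensorPow_mul, ← Matrix.star_eq_conjTranspose, Matrix.UnitaryGroup.star_mul_self,
      tensorPow_one]
  rw [Commute, SemiconjBy]
  conv_lhs => rw [← h]
  rw [Matrix.mul_assoc, hW, Matrix.mul_one]

theorem sum_momentMatrix_comp (j j' : P → Fin n) (τ : Equiv.Perm P) :
    ∑ g : P → Fin n, momentMatrix μ j j' (g ∘ τ) g = if j = j' ∘ τ then 1 else 0 := by
  simp only [momentMatrix, Matrix.of_apply]
  rw [← integral_finsetSum _ fun g _ => integrable_moment μ _ _ _ _]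
  have h : ∀ U : Matrix.unitaryGroup (Fin n) ℂ,
      ∑ g : P → Fin n, (∏ t, (U : Matrix (Fin n) (Fin n) ℂ) ((g ∘ τ) t) (j t)) *
        ∏ t, star ((U : Matrix (Fin n) (Fin n) ℂ) (g t) (j' t)) =
      if j = j' ∘ τ then 1 else 0 := by
    intro U
    have h1 : ∀ g : P → Fin n, (∏ t, (U : Matrix (Fin n) (Fin n) ℂ) ((g ∘ τ) t) (j t)) *
        ∏ t, star ((U : Matrix (Fin n) (Fin n) ℂ) (g t) (j' t)) =
        ∏ t, ((U : Matrix (Fin n) (Fin n) ℂ)ᴴ (j' t) (g t) *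
          (U : Matrix (Fin n) (Fin n) ℂ) (g t) ((j ∘ τ.symm) t)) := by
      intro g
      rw [Finset.prod_mul_distrib, mul_comm]
      congr 1
      exact Fintype.prod_equiv τ _ _ fun t => by simp
    simp_rw [h1]
    rw [← Fintype.prod_sum fun t b => (U : Matrix (Fin n) (Fin n) ℂ)ᴴ (j' t) b *
          (U : Matrix (Fin n) (Fin n) ℂ) b ((j ∘ τ.symm) t)]
    simp_rw [← Matrix.mul_apply]
    rw [← tensorPow_apply, ← Matrix.star_eq_conjTranspose, Matrix.UnitaryGroup.star_mul_self,
      tensorPow_one, Matrix.one_apply]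
    congr 1
    rw [eq_iff_iff, Equiv.eq_comp_symm, eq_comm]
  simp_rw [h]
  simp

/-- The Weingarten formula for a single Haar unitary. -/
theorem weingarten_formula [μ.IsHaarMeasure] (hn : Fintype.card P ≤ n) (i i' j j' : P → Fin n) :
    ∫ U : Matrix.unitaryGroup (Fin n) ℂ,
      (∏ t, (U : Matrix (Fin n) (Fin n) ℂ) (i t) (j t)) *
        ∏ t, star ((U : Matrix (Fin n) (Fin n) ℂ) (i' t) (j' t)) ∂μ =
    ∑ α : Equiv.Perm P, ∑ β : Equiv.Perm P,
      (∏ t, if i t = i' (α t) then (1 : ℂ) else 0) *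
      (∏ t, if j t = j' (β t) then (1 : ℂ) else 0) * (Wg n (α⁻¹ * β) : ℂ) := by
  obtain ⟨c, hc⟩ := exists_coeff_of_commute hn (commute_momentMatrix μ j j')
  have hgram : ∀ τ : Equiv.Perm P, ∑ α, c α * (n : ℂ) ^ numCycles (τ⁻¹ * α) =
      if j = j' ∘ τ then 1 else 0 := by
    intro τ
    rw [← sum_momentMatrix_comp μ j j' τ]
    simp_rw [hc, ← sum_indicator_comp ℂ n τ, Finset.mul_sum]
    exact Finset.sum_comm
  have hprod : ∀ (a b : P → Fin n), (∏ t, if a t = b t then (1 : ℂ) else 0) =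
      if a = b then 1 else 0 := by
    intro a b
    simp only [Finset.prod_ite_zero, Finset.prod_const_one, funext_iff, Finset.mem_univ,
      true_imp_iff]
  refine (hc i i').trans (Finset.sum_congr rfl fun α _ => ?_)
  rw [eq_sum_Wg_of_gram hn c _ hgram α, Finset.sum_mul]
  refine Finset.sum_congr rfl fun β _ => ?_
  rw [← hprod, ← hprod]
  simp only [Function.comp_apply]
  ring

end Haar

section Independent

variable {n k : ℕ}

/-- The moment vanishes if some `U^{(s)}` and its conjugate occur a different number of times. -/
theorem integral_eq_zero_of_card_fiber_ne {P P' : Type*} [Fintype P] [Fintype P']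
    (μ : Measure (Matrix.unitaryGroup (Fin n) ℂ)) [μ.IsHaarMeasure] [IsProbabilityMeasure μ]
    (i j : P → Fin n) (l : P → Fin k) (i' j' : P' → Fin n) (l' : P' → Fin k) {s : Fin k}
    (hs : Fintype.card {t // l t = s} ≠ Fintype.card {t // l' t = s}) :
    ∫ U : Fin k → Matrix.unitaryGroup (Fin n) ℂ,
      ((∏ t, ((U (l t) : Matrix (Fin n) (Fin n) ℂ) (i t) (j t))) *
        ∏ t, star ((U (l' t) : Matrix (Fin n) (Fin n) ℂ) (i' t) (j' t)))
      ∂(Measure.pi fun _ : Fin k => μ) = 0 := by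
  set z : ℂ := Complex.exp Complex.I
  have hzz : star z * z = 1 := star_exp_I_mul
  let w : Matrix.unitaryGroup (Fin n) ℂ := ⟨z • 1, by
    rw [Matrix.mem_unitaryGroup_iff', star_smul, star_one, smul_mul_smul_comm, hzz, one_mul,
      one_smul]⟩
  let g : Fin k → Matrix.unitaryGroup (Fin n) ℂ := Function.update 1 s w
  have hg : ∀ (U : Fin k → Matrix.unitaryGroup (Fin n) ℂ) (r : Fin k) (a b : Fin n),
      (((g * U) r : Matrix.unitaryGroup (Fin n) ℂ) : Matrix (Fin n) (Fin n) ℂ) a b =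
        (if r = s then z else 1) * (U r : Matrix (Fin n) (Fin n) ℂ) a b := by
    intro U r a b
    by_cases h : r = s
    · subst h
      simp [g, w]
    · simp [g, h]
  let F : (Fin k → Matrix.unitaryGroup (Fin n) ℂ) → ℂ := fun U =>
    (∏ t, ((U (l t) : Matrix (Fin n) (Fin n) ℂ) (i t) (j t))) *
      ∏ t, star ((U (l' t) : Matrix (Fin n) (Fin n) ℂ) (i' t) (j' t))
  have hF : ∀ U, F (g * U) = (z ^ Fintype.card {t // l t = s} *
      star z ^ Fintype.card {t // l' t = s}) * F U := by
    intro U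
    simp only [F, hg, star_mul', Finset.prod_mul_distrib, prod_ite_eq_pow_card,
      apply_ite (star : ℂ → ℂ), star_one]
    ring
  have hI := integral_mul_left_eq_self (μ := Measure.pi fun _ : Fin k => μ) F g
  simp_rw [hF] at hI
  rw [integral_const_mul] at hI
  by_contra h0
  have h1 := mul_right_cancel₀ h0 (hI.trans (one_mul _).symm)
  refine hs (exp_I_pow_injective ?_)
  change z ^ _ = z ^ _
  calc z ^ Fintype.card {t // l t = s}
      = (z ^ Fintype.card {t // l t = s} * star z ^ Fintype.card {t // l' t = s}) *
          z ^ Fintype.card {t // l' t = s} := by rw [mul_assoc, ← mul_pow, hzz, one_pow, mul_one]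
    _ = z ^ Fintype.card {t // l' t = s} := by rw [h1, one_mul]

variable {p : ℕ}

/-- The permutation assembled from permutations of the level sets of `l`. -/
def gluePerm (l : Fin p → Fin k) (a : ∀ s, Equiv.Perm {t : Fin p // l t = s}) :
    Equiv.Perm (Fin p) :=
  (Equiv.sigmaFiberEquiv l).symm.trans
    ((Equiv.sigmaCongrRight a).trans (Equiv.sigmaFiberEquiv l))

theorem gluePerm_apply (l : Fin p → Fin k) (a : ∀ s, Equiv.Perm {t : Fin p // l t = s})
    (s : Fin k) (t : {t : Fin p // l t = s}) : gluePerm l a t = a s t := by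
  obtain ⟨t, rfl⟩ := t
  rfl

theorem level_gluePerm (l : Fin p → Fin k) (a : ∀ s, Equiv.Perm {t : Fin p // l t = s})
    (t : Fin p) : l (gluePerm l a t) = l t :=
  (a (l t) ⟨t, rfl⟩).2

theorem gluePerm_injective (l : Fin p → Fin k) : Function.Injective (gluePerm l) := by
  intro a b h
  funext s
  ext t
  rw [← gluePerm_apply, ← gluePerm_apply, h]

theorem gluePerm_restrictPerm (l : Fin p → Fin k) (σ : Equiv.Perm (Fin p))
    (h : ∀ t, l (σ t) = l t) : gluePerm l (restrictPerm l σ h) = σ := by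
  ext t
  rfl

theorem restrictPerm_congr (l : Fin p → Fin k) {σ τ : Equiv.Perm (Fin p)} (e : σ = τ)
    (h : ∀ t, l (σ t) = l t) (h' : ∀ t, l (τ t) = l t) (s : Fin k) :
    restrictPerm l σ h s = restrictPerm l τ h' s := by
  subst e
  rfl

theorem restrictPerm_gluePerm_inv_mul (l : Fin p → Fin k)
    (a b : ∀ s, Equiv.Perm {t : Fin p // l t = s})
    (h : ∀ t, l (((gluePerm l a)⁻¹ * gluePerm l b) t) = l t) (s : Fin k) :
    restrictPerm l ((gluePerm l a)⁻¹ * gluePerm l b) h s = (a s)⁻¹ * b s := by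
  refine Equiv.ext fun t => Subtype.ext ?_
  change ((gluePerm l a)⁻¹ * gluePerm l b) (t : Fin p) = _
  rw [Equiv.Perm.mul_apply, Equiv.Perm.inv_eq_iff_eq, gluePerm_apply, gluePerm_apply]
  simp

theorem sum_sum_levelPreserving (l : Fin p → Fin k)
    (F : ∀ α β : Equiv.Perm (Fin p), (∀ t, l (α t) = l t) ∧ (∀ t, l (β t) = l t) → ℂ) :
    (∑ α : Equiv.Perm (Fin p), ∑ β : Equiv.Perm (Fin p),
      if h : (∀ t, l (α t) = l t) ∧ (∀ t, l (β t) = l t) then F α β h else 0) =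
    ∑ a : ∀ s, Equiv.Perm {t : Fin p // l t = s}, ∑ b : ∀ s, Equiv.Perm {t : Fin p // l t = s},
      F (gluePerm l a) (gluePerm l b) ⟨level_gluePerm l a, level_gluePerm l b⟩ := by
  symm
  refine Finset.sum_of_injOn (gluePerm l) (gluePerm_injective l).injOn (by simp) ?_ ?_
  · intro α _ hα
    refine Finset.sum_eq_zero fun β _ => dif_neg fun h => hα ?_
    exact ⟨restrictPerm l α h.1, by simp, gluePerm_restrictPerm l α h.1⟩
  · intro a _
    refine Finset.sum_of_injOn (gluePerm l) (gluePerm_injective l).injOn (by simp) ?_ ?_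
    · intro β _ hβ
      refine dif_neg fun h => hβ ?_
      exact ⟨restrictPerm l β h.2, by simp, gluePerm_restrictPerm l β h.2⟩
    · intro b _
      exact (dif_pos ⟨level_gluePerm l a, level_gluePerm l b⟩).symm

theorem weingarten_formula_same_level (hn : p ≤ n)
    (i i' j j' : Fin p → Fin n) (l : Fin p → Fin k)
    (μ : Measure (Matrix.unitaryGroup (Fin n) ℂ)) [μ.IsHaarMeasure] [IsProbabilityMeasure μ] :
    ∫ U : Fin k → Matrix.unitaryGroup (Fin n) ℂ,
        ((∏ t, ((U (l t) : Matrix (Fin n) (Fin n) ℂ) (i t) (j t))) *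
          ∏ t, star ((U (l t) : Matrix (Fin n) (Fin n) ℂ) (i' t) (j' t)))
        ∂(Measure.pi fun _ : Fin k => μ) =
      ∑ α : Equiv.Perm (Fin p), ∑ β : Equiv.Perm (Fin p),
        (if h : (∀ t, l (α t) = l t) ∧ (∀ t, l (β t) = l t) then
          (∏ t, if i t = i' (α t) then (1 : ℂ) else 0) *
          (∏ t, if j t = j' (β t) then (1 : ℂ) else 0) *
          ((∏ s : Fin k,
            Wg n (restrictPerm l (α⁻¹ * β) (levelPreserving l l α β h.1 h.2) s) : ℝ) : ℂ)
        else 0) := by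
  rw [sum_sum_levelPreserving l fun α β h =>
    (∏ t, if i t = i' (α t) then (1 : ℂ) else 0) *
      (∏ t, if j t = j' (β t) then (1 : ℂ) else 0) *
      ((∏ s : Fin k,
        Wg n (restrictPerm l (α⁻¹ * β) (levelPreserving l l α β h.1 h.2) s) : ℝ) : ℂ)]
  have hcard : ∀ s, Fintype.card {t : Fin p // l t = s} ≤ n := fun s =>
    (Fintype.card_subtype_le _).trans (by simpa using hn)
  calc _ = ∫ U : Fin k → Matrix.unitaryGroup (Fin n) ℂ, ∏ s,
          ((∏ t : {t // l t = s}, (U s : Matrix (Fin n) (Fin n) ℂ) (i t) (j t)) *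
            ∏ t : {t // l t = s}, star ((U s : Matrix (Fin n) (Fin n) ℂ) (i' t) (j' t)))
          ∂(Measure.pi fun _ : Fin k => μ) := by
        refine integral_congr_ae (Filter.Eventually.of_forall fun U => ?_)
        simp only [Finset.prod_mul_distrib]
        congr 1
        · rw [← Fintype.prod_fiberwise l]
          refine Finset.prod_congr rfl fun s _ => Finset.prod_congr rfl fun t _ => ?_
          rw [t.2]
        · rw [← Fintype.prod_fiberwise l]
          refine Finset.prod_congr rfl fun s _ => Finset.prod_congr rfl fun t _ => ?_
          rw [t.2]
    _ = ∏ s, ∫ U : Matrix.unitaryGroup (Fin n) ℂ,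
          ((∏ t : {t // l t = s}, (U : Matrix (Fin n) (Fin n) ℂ) (i t) (j t)) *
            ∏ t : {t // l t = s}, star ((U : Matrix (Fin n) (Fin n) ℂ) (i' t) (j' t))) ∂μ :=
        integral_fintype_prod_eq_prod (μ := fun _ : Fin k => μ)
          fun s (U : Matrix.unitaryGroup (Fin n) ℂ) =>
          ((∏ t : {t // l t = s}, (U : Matrix (Fin n) (Fin n) ℂ) (i t) (j t)) *
            ∏ t : {t // l t = s}, star ((U : Matrix (Fin n) (Fin n) ℂ) (i' t) (j' t)))
    _ = ∏ s, ∑ α : Equiv.Perm {t // l t = s}, ∑ β : Equiv.Perm {t // l t = s},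
          (∏ t : {t // l t = s}, if i t = i' (α t) then (1 : ℂ) else 0) *
          (∏ t : {t // l t = s}, if j t = j' (β t) then (1 : ℂ) else 0) *
            (Wg n (α⁻¹ * β) : ℂ) := by
        refine Finset.prod_congr rfl fun s _ => ?_
        exact weingarten_formula μ (hcard s) (fun t : {t // l t = s} => i t) (fun t => i' t)
          (fun t => j t) (fun t => j' t)
    _ = _ := by
        rw [Fintype.prod_sum]
        refine Finset.sum_congr rfl fun a _ => ?_
        rw [Fintype.prod_sum]
        refine Finset.sum_congr rfl fun b _ => ?_
        rw [Finset.prod_mul_distrib, Finset.prod_mul_distrib, Complex.ofReal_prod]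
        simp only [restrictPerm_gluePerm_inv_mul]
        rw [← Fintype.prod_fiberwise l fun t => if i t = i' (gluePerm l a t) then (1 : ℂ) else 0,
          ← Fintype.prod_fiberwise l fun t => if j t = j' (gluePerm l b t) then (1 : ℂ) else 0]
        simp only [gluePerm_apply]

end Independent

/-- **Generalized Weingarten formula** for several independent Haar unitary matrices.
`μ` is the Haar probability measure on `U(n)`, and `U = (U^{(1)}, …, U^{(k)})` is distributed
according to the product of `k` copies of `μ`, i.e. the `U^{(s)}` are i.i.d. Haar unitaries.
The first conjunct is the case where there are as many `U` factors as conjugated factors;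
the second conjunct asserts that the expectation vanishes when the numbers `p ≠ p'` of
`U`-factors and conjugate factors differ. -/
theorem generalized_weingarten_formula
    (n k p : ℕ) (hn : p ≤ n) (hn0 : 0 < n) (hk : 0 < k)
    (i i' j j' : Fin p → Fin n) (l l' : Fin p → Fin k)
    (μ : Measure (Matrix.unitaryGroup (Fin n) ℂ))
    [μ.IsHaarMeasure] [IsProbabilityMeasure μ] :
    (∫ U : Fin k → Matrix.unitaryGroup (Fin n) ℂ,
        ((∏ t, ((U (l t) : Matrix (Fin n) (Fin n) ℂ) (i t) (j t))) *
          ∏ t, star ((U (l' t) : Matrix (Fin n) (Fin n) ℂ) (i' t) (j' t)))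
        ∂(Measure.pi fun _ : Fin k => μ)) =
      ∑ α : Equiv.Perm (Fin p), ∑ β : Equiv.Perm (Fin p),
        (if h : (∀ t, l' (α t) = l t) ∧ (∀ t, l' (β t) = l t) then
          (∏ t, if i t = i' (α t) then (1 : ℂ) else 0) *
          (∏ t, if j t = j' (β t) then (1 : ℂ) else 0) *
          ((∏ s : Fin k,
            Wg n (restrictPerm l (α⁻¹ * β) (levelPreserving l l' α β h.1 h.2) s) : ℝ) : ℂ)
        else 0) ∧
    (∀ p' : ℕ, p ≠ p' → ∀ (i₂ j₂ : Fin p → Fin n) (l₂ : Fin p → Fin k)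
        (i₂' j₂' : Fin p' → Fin n) (l₂' : Fin p' → Fin k),
      (∫ U : Fin k → Matrix.unitaryGroup (Fin n) ℂ,
        ((∏ t, ((U (l₂ t) : Matrix (Fin n) (Fin n) ℂ) (i₂ t) (j₂ t))) *
          ∏ t, star ((U (l₂' t) : Matrix (Fin n) (Fin n) ℂ) (i₂' t) (j₂' t)))
        ∂(Measure.pi fun _ : Fin k => μ)) = 0) := by
  constructor
  · by_cases hcard : ∀ s, Fintype.card {t // l t = s} = Fintype.card {t // l' t = s}
    · obtain ⟨γ, hγ⟩ := exists_equiv_comp_eq l l' hcard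
      have h := weingarten_formula_same_level hn i (i' ∘ γ) j (j' ∘ γ) l μ
      have hprod : ∀ U : Fin k → Matrix.unitaryGroup (Fin n) ℂ,
          ∏ t, star ((U (l' t) : Matrix (Fin n) (Fin n) ℂ) (i' t) (j' t)) =
          ∏ t, star ((U (l t) : Matrix (Fin n) (Fin n) ℂ) ((i' ∘ γ) t) ((j' ∘ γ) t)) := by
        intro U
        rw [← Equiv.prod_comp γ]
        simp only [hγ, Function.comp_apply]
      simp_rw [hprod]
      rw [h]
      refine Fintype.sum_equiv (Equiv.mulLeft γ) _ _ fun α =>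
        Fintype.sum_equiv (Equiv.mulLeft γ) _ _ fun β => ?_
      have hiff : ((∀ t, l' (Equiv.mulLeft γ α t) = l t) ∧
          ∀ t, l' (Equiv.mulLeft γ β t) = l t) ↔
          (∀ t, l (α t) = l t) ∧ ∀ t, l (β t) = l t := by
        simp [hγ]
      by_cases hαβ : (∀ t, l (α t) = l t) ∧ ∀ t, l (β t) = l t
      · rw [dif_pos hαβ, dif_pos (hiff.2 hαβ)]
        congr 2
        refine Finset.prod_congr rfl fun s _ => ?_
        exact congrArg _ (restrictPerm_congr l (by simp) _ _ s)
      · rw [dif_neg hαβ, dif_neg (hiff.not.2 hαβ)]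
    · push Not at hcard
      obtain ⟨s, hs⟩ := hcard
      rw [integral_eq_zero_of_card_fiber_ne μ i j l i' j' l' hs]
      symm
      refine Finset.sum_eq_zero fun α _ => Finset.sum_eq_zero fun β _ => dif_neg fun h => hs ?_
      exact Fintype.card_congr (α.subtypeEquiv fun t => by rw [h.1])
  · intro p' hp i₂ j₂ l₂ i₂' j₂' l₂'
    obtain ⟨s, hs⟩ : ∃ s, Fintype.card {t // l₂ t = s} ≠ Fintype.card {t // l₂' t = s} := by
      by_contra! h
      obtain ⟨σ, -⟩ := exists_equiv_comp_eq l₂ l₂' h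
      exact hp (by simpa using Fintype.card_congr σ)
    exact integral_eq_zero_of_card_fiber_ne μ i₂ j₂ l₂ i₂' j₂' l₂' hs
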